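/- The longest binary partial word with exactly one hole containing at most a ≥ 2 distinct squares and at most one distinct antisquare has length exactly 4a-1. -/

import Mathlib

/-- A full binary word `u` is compatible with a partial word `v`
(over `Option Bool`, where `none` is the hole). -/
def Compat (u : List Bool) (v : List (Option Bool)) : Prop :=
  u.length = v.length ∧
    ∀ i, i < u.length → ∀ b : Bool, v.getD i none = some b → u.getD i false = b

/-- The set of distinct full-word squares `x ++ x` compatible with a factor of `w`. -/
def SqSet (w : List (Option Bool)) : Set (List Bool) :=
  {u | ∃ x : List Bool, x ≠ [] ∧ u = x ++ x ∧ ∃ v, v <:+: w ∧ Compat u v}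

/-- A full binary word of even positive length `2n` with `u[i] ≠ u[n+i]` for all `i < n`. -/
def IsAntisquare (u : List Bool) : Prop :=
  u ≠ [] ∧ u.length % 2 = 0 ∧
    ∀ i, i < u.length / 2 → u.getD i false ≠ u.getD (u.length / 2 + i) false

/-- The set of distinct antisquares occurring as (hole-free) factors of `w`. -/
def AntiSet (w : List (Option Bool)) : Set (List Bool) :=
  {u | IsAntisquare u ∧ u.map some <:+: w}

/-- `w` contains exactly one hole. -/
def OneHole (w : List (Option Bool)) : Prop := w.count none = 1

theorem infix_idx {α : Type*} {v w : List α} (h : v <:+: w) :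
    ∃ d, d + v.length ≤ w.length ∧ ∀ i, i < v.length → v[i]? = w[d+i]? := by
  obtain ⟨s, t, rfl⟩ := h
  refine ⟨s.length, by simp, fun i hi => ?_⟩
  grind

theorem sq_of_fill (P Q : List Bool) (b : Bool) (x : List Bool) (hx : x ≠ [])
    (h : x ++ x <:+: P ++ b :: Q) : x ++ x ∈ SqSet (P.map some ++ none :: Q.map some) := by
  refine ⟨x, hx, rfl, ?_⟩
  obtain ⟨s, t, hst⟩ := h
  set w := P.map some ++ none :: Q.map some with hw
  have hlen : w.length = s.length + (x ++ x).length + t.length := by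
    have := congrArg List.length hst
    simp [hw] at this ⊢
    omega
  refine ⟨(w.drop s.length).take (x ++ x).length, ?_, ?_, ?_⟩
  · exact (List.take_prefix _ _).isInfix.trans (List.drop_suffix _ _).isInfix
  · rw [List.length_take, List.length_drop]; omega
  · intro i hi c hc
    have h1 : (P ++ b :: Q)[s.length + i]? = (x ++ x)[i]? := by
      rw [← hst]; grind
    have h2 : w[s.length + i]? = some (some c) := by
      rw [List.getD_eq_getElem?_getD, List.getElem?_take, if_pos hi, List.getElem?_drop] at hc
      cases h : w[s.length + i]? with
      | none => rw [h] at hc; simp at hc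
      | some y => rw [h] at hc; simp at hc; rw [hc]
    rw [List.getD_eq_getElem?_getD, ← h1]
    rw [hw] at h2
    simp only [List.getElem?_append, List.getElem?_cons, List.length_map, List.getElem?_map] at h2 ⊢
    grind

theorem sq_finite (w : List (Option Bool)) : (SqSet w).Finite := by
  apply (List.finite_length_le Bool w.length).subset
  rintro u ⟨x, _, _, v, hv, hc⟩
  have := hv.length_le
  have := hc.1
  simp only [Set.mem_ofPred_eq]
  omega

theorem anti_finite (w : List (Option Bool)) : (AntiSet w).Finite := by
  apply (List.finite_length_le Bool w.length).subset
  rintro u ⟨_, hv⟩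
  have := hv.length_le
  simpa using this

/-- squares that are powers of `c` -/
def unarySq (c : Bool) (z : ℕ) : Finset (List Bool) :=
  (Finset.range (z / 2)).image (fun m => List.replicate (2 * (m + 1)) c)

theorem unarySq_card (c : Bool) (z : ℕ) : (unarySq c z).card = z / 2 := by
  unfold unarySq
  rw [Finset.card_image_of_injective, Finset.card_range]
  intro m n h
  have := congrArg List.length h
  simp at this
  exact this

theorem unarySq_mem {c : Bool} {z : ℕ} {u : List Bool} (h : u ∈ unarySq c z) :
    u ≠ [] ∧ ∀ y ∈ u, y = c := by
  unfold unarySq at h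
  simp only [Finset.mem_image] at h
  obtain ⟨m, _, rfl⟩ := h
  refine ⟨by simp, fun y hy => List.eq_of_mem_replicate hy⟩

theorem unarySq_sub (P Q : List Bool) (c b : Bool) (z : ℕ)
    (h : List.replicate z c <:+: P ++ b :: Q) :
    ∀ u ∈ unarySq c z, u ∈ SqSet (P.map some ++ none :: Q.map some) := by
  intro u hu
  unfold unarySq at hu
  simp only [Finset.mem_image, Finset.mem_range] at hu
  obtain ⟨m, hm, rfl⟩ := hu
  have : List.replicate (2 * (m + 1)) c = List.replicate (m + 1) c ++ List.replicate (m + 1) c := by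
    rw [← List.replicate_add, two_mul]
  rw [this]
  apply sq_of_fill _ _ b _ (by simp)
  rw [← this]
  refine List.IsInfix.trans ?_ h
  refine ⟨[], List.replicate (z - 2 * (m + 1)) c, ?_⟩
  rw [List.nil_append, ← List.replicate_add]
  congr 1
  omega

theorem disj_unary (c : Bool) (z o : ℕ) : Disjoint (unarySq c z) (unarySq (!c) o) := by
  rw [Finset.disjoint_left]
  intro u h1 h2
  obtain ⟨hn, h1⟩ := unarySq_mem h1
  obtain ⟨_, h2⟩ := unarySq_mem h2
  obtain ⟨y, hy⟩ := List.exists_mem_of_ne_nil u hn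
  have e := (h1 y hy).symm.trans (h2 y hy)
  cases c <;> simp at e

theorem count1 (P Q : List Bool) (c b b' : Bool) (z o a : ℕ)
    (ha : (SqSet (P.map some ++ none :: Q.map some)).ncard ≤ a)
    (hz : List.replicate z c <:+: P ++ b :: Q)
    (ho : List.replicate o (!c) <:+: P ++ b' :: Q) : z / 2 + o / 2 ≤ a := by
  refine le_trans ?_ ha
  rw [← unarySq_card c z, ← unarySq_card (!c) o, ← Finset.card_union_of_disjoint (disj_unary c z o),
    ← Set.ncard_coe_finset]
  apply Set.ncard_le_ncard _ (sq_finite _)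
  intro u hu
  simp only [Finset.coe_union, Set.mem_union, Finset.mem_coe] at hu
  rcases hu with hu | hu
  · exact unarySq_sub P Q c b z hz u hu
  · exact unarySq_sub P Q (!c) b' o ho u hu

theorem count2 (P Q : List Bool) (c b b' b'' : Bool) (z o a : ℕ) (x : List Bool)
    (ha : (SqSet (P.map some ++ none :: Q.map some)).ncard ≤ a)
    (hz : List.replicate z c <:+: P ++ b :: Q)
    (ho : List.replicate o (!c) <:+: P ++ b' :: Q)
    (hx : x ++ x <:+: P ++ b'' :: Q) (h0 : c ∈ x) (h1 : (!c) ∈ x) : z / 2 + o / 2 + 1 ≤ a := by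
  refine le_trans ?_ ha
  have hni : x ++ x ∉ unarySq c z ∪ unarySq (!c) o := by
    intro h
    rcases Finset.mem_union.1 h with h | h
    · have := (unarySq_mem h).2 (!c) (by simp [h1])
      cases c <;> simp at this
    · have := (unarySq_mem h).2 c (by simp [h0])
      cases c <;> simp at this
  rw [← unarySq_card c z, ← unarySq_card (!c) o, ← Finset.card_union_of_disjoint (disj_unary c z o),
    ← Finset.card_insert_of_notMem hni, ← Set.ncard_coe_finset]
  apply Set.ncard_le_ncard _ (sq_finite _)
  intro u hu
  simp only [Finset.coe_insert, Finset.coe_union, Set.mem_insert_iff, Set.mem_union,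
    Finset.mem_coe] at hu
  rcases hu with hu | hu | hu
  · rw [hu]
    exact sq_of_fill P Q b'' x (List.ne_nil_of_mem h0) hx
  · exact unarySq_sub P Q c b z hz u hu
  · exact unarySq_sub P Q (!c) b' o ho u hu

theorem main_bound (a : ℕ) (ha : 2 ≤ a) (c : Bool) (i j k l : ℕ)
    (hij : i ≤ 1 ∨ j ≤ 1) (hkl : k ≤ 1 ∨ l ≤ 1) (P Q : List Bool)
    (hP : P = List.replicate i c ++ List.replicate j (!c))
    (hQ : Q = List.replicate k c ++ List.replicate l (!c))
    (h : (SqSet (P.map some ++ none :: Q.map some)).ncard ≤ a) :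
    i + j + k + l + 1 ≤ 4 * a - 1 := by
  have z1 : List.replicate i c <:+: P ++ c :: Q :=
    ⟨[], List.replicate j (!c) ++ c :: Q, by simp [hP]⟩
  have z2 : List.replicate (k + 1) c <:+: P ++ c :: Q :=
    ⟨P, List.replicate l (!c), by simp [hQ, List.replicate_succ]⟩
  have z3 : j = 0 → List.replicate (i + (k + 1)) c <:+: P ++ c :: Q := fun hj =>
    ⟨[], List.replicate l (!c), by
      subst hj; simp [hP, hQ, List.replicate_succ, List.replicate_add]⟩
  have o1 : List.replicate (j + 1) (!c) <:+: P ++ (!c) :: Q :=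
    ⟨List.replicate i c, Q, by simp [hP, List.replicate_add]⟩
  have o2 : List.replicate l (!c) <:+: P ++ (!c) :: Q :=
    ⟨P ++ (!c) :: List.replicate k c, [], by simp [hQ]⟩
  have o3 : k = 0 → List.replicate (j + (l + 1)) (!c) <:+: P ++ (!c) :: Q := fun hk =>
    ⟨List.replicate i c, [], by
      subst hk; simp [hP, hQ, List.replicate_succ, List.replicate_add]⟩
  have C := fun b b' z o hz ho => count1 P Q c b b' z o a h hz ho
  have c11 := C _ _ _ _ z1 o1
  have c12 := C _ _ _ _ z1 o2
  have c21 := C _ _ _ _ z2 o1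
  have c22 := C _ _ _ _ z2 o2
  have c13 := fun hk => C _ _ _ _ z1 (o3 hk)
  have c23 := fun hk => C _ _ _ _ z2 (o3 hk)
  have c31 := fun hj => C _ _ _ _ (z3 hj) o1
  have c32 := fun hj => C _ _ _ _ (z3 hj) o2
  have E := fun b b' b'' z o x hz ho hx h0 h1 => count2 P Q c b b' b'' z o a x h hz ho hx h0 h1
  have e1 : i = 1 → k = 1 → l = j + 1 → (k + 1) / 2 + (j + 1) / 2 + 1 ≤ a := by
    intro hi hk hl
    refine E _ _ (!c) _ _ (c :: List.replicate (j + 1) (!c)) z2 o1 ⟨[], [], ?_⟩ (by simp) (by simp)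
    subst hi hk hl
    simp [hP, hQ, List.replicate_add]
  have e2 : j = 1 → l = 1 → i = k + 1 → (k + 1) / 2 + (j + 1) / 2 + 1 ≤ a := by
    intro hj hl hi
    refine E _ _ c _ _ (List.replicate (k + 1) c ++ [!c]) z2 o1 ⟨[], [], ?_⟩ (by simp) (by simp)
    subst hi hj hl
    simp [hP, hQ, List.replicate_succ]
  have e3 : j = 1 → k = 1 → 2 ≤ i → 1 ≤ l → i / 2 + l / 2 + 1 ≤ a := by
    intro hj hk hi hl
    refine E _ _ c _ _ [c, c, !c] z1 o2
      ⟨List.replicate (i - 2) c, List.replicate (l - 1) (!c), ?_⟩ (by simp) (by simp)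
    obtain ⟨i, rfl⟩ := Nat.exists_eq_add_of_le' hi
    obtain ⟨l, rfl⟩ := Nat.exists_eq_add_of_le hl
    subst hj hk
    simp [hP, hQ, List.replicate_add]
  rcases Nat.eq_zero_or_pos j with hj | hj
  · have := c31 hj
    have := c32 hj
    rcases Nat.eq_zero_or_pos k with hk | hk
    · have := c13 hk
      have := c23 hk
      clear C E
      omega
    · clear C E c13 c23 e1 e2 e3
      omega
  · rcases Nat.eq_zero_or_pos k with hk | hk
    · have := c13 hk
      have := c23 hk
      clear C E e1 e2 e3
      omega
    · clear C E c13 c23 c31 c32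
      omega

theorem shape (c : Bool) (P : List Bool) (h : ¬ [!c, c] <:+: P) :
    ∃ i j, P = List.replicate i c ++ List.replicate j (!c) := by
  induction P with
  | nil => exact ⟨0, 0, rfl⟩
  | cons y P ih =>
    obtain ⟨i, j, hP⟩ := ih (fun h' => h (h'.trans (List.suffix_cons y P).isInfix))
    by_cases hy : y = c
    · exact ⟨i + 1, j, by rw [hP, hy]; simp [List.replicate_succ]⟩
    · have hy : y = !c := by cases y <;> cases c <;> simp_all
      rcases i with _ | i
      · exact ⟨0, j + 1, by rw [hP, hy]; simp [List.replicate_succ]⟩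
      · exfalso
        apply h
        exact ⟨[], List.replicate i c ++ List.replicate j (!c), by
          rw [hP, hy]; simp [List.replicate_succ]⟩

theorem shape2 (c : Bool) (w : List (Option Bool)) (P : List Bool) (hw : P.map some <:+: w)
    (hA : ∀ u ∈ AntiSet w, ∀ v ∈ AntiSet w, u = v)
    (i j : ℕ) (hP : P = List.replicate i c ++ List.replicate j (!c)) : i ≤ 1 ∨ j ≤ 1 := by
  by_contra hcon
  push Not at hcon
  obtain ⟨i, rfl⟩ := Nat.exists_eq_add_of_le' hcon.1
  obtain ⟨j, rfl⟩ := Nat.exists_eq_add_of_le hcon.2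
  have h1 : [c, !c] ∈ AntiSet w := by
    refine ⟨⟨by simp, by simp, ?_⟩, List.IsInfix.trans (List.IsInfix.map some ?_) hw⟩
    · intro i hi
      have : i = 0 := by simp at hi; omega
      subst this
      cases c <;> simp
    · exact ⟨List.replicate i c ++ [c], (!c) :: List.replicate j (!c), by
        rw [hP]; simp [List.replicate_add]⟩
  have h2 : [c, c, !c, !c] ∈ AntiSet w := by
    refine ⟨⟨by simp, by simp, ?_⟩, List.IsInfix.trans (List.IsInfix.map some ?_) hw⟩
    · intro i hi
      have : i = 0 ∨ i = 1 := by simp at hi; omega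
      rcases this with rfl | rfl <;> cases c <;> simp
    · exact ⟨List.replicate i c, List.replicate j (!c), by
        rw [hP]; simp [List.replicate_add]⟩
  have := hA _ h1 _ h2
  simp at this

theorem hole_split (w : List (Option Bool)) (h : w.count none = 1) :
    ∃ P Q : List Bool, w = P.map some ++ none :: Q.map some := by
  have full : ∀ v : List (Option Bool), v.count none = 0 → ∃ P : List Bool, v = P.map some := by
    intro v
    induction v with
    | nil => exact fun _ => ⟨[], rfl⟩
    | cons y v ih =>
      intro hv
      cases y with
      | none => simp at hv
      | some y =>
        obtain ⟨P, hP⟩ := ih (by simpa using hv)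
        exact ⟨y :: P, by simp [hP]⟩
  have hm : none ∈ w := List.count_pos_iff.1 (by omega)
  obtain ⟨s, t, rfl⟩ := List.append_of_mem hm
  simp at h
  obtain ⟨P, rfl⟩ := full s (by omega)
  obtain ⟨Q, rfl⟩ := full t (by omega)
  exact ⟨P, Q, rfl⟩

theorem upper (a : ℕ) (ha : 2 ≤ a) (w : List (Option Bool)) (h1 : OneHole w)
    (h2 : (SqSet w).ncard ≤ a) (h3 : (AntiSet w).ncard ≤ 1) : w.length ≤ 4 * a - 1 := by
  have hA := (Set.ncard_le_one (anti_finite w)).1 h3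
  obtain ⟨P, Q, rfl⟩ := hole_split w h1
  have hPw : P.map some <:+: P.map some ++ none :: Q.map some := (List.prefix_append _ _).isInfix
  have hQw : Q.map some <:+: P.map some ++ none :: Q.map some :=
    ⟨P.map some ++ [none], [], by simp⟩
  have hc : ∃ c : Bool, [!c, c] ∉ AntiSet (P.map some ++ none :: Q.map some) := by
    by_contra hcon
    push Not at hcon
    have := hA _ (hcon true) _ (hcon false)
    simp at this
  obtain ⟨c, hc⟩ := hc
  have hanti : IsAntisquare [!c, c] := by
    refine ⟨by simp, by simp, ?_⟩
    intro i hi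
    have : i = 0 := by simp at hi; omega
    subst this
    cases c <;> simp
  obtain ⟨i, j, hP⟩ := shape c P (fun h => hc ⟨hanti, (h.map some).trans hPw⟩)
  obtain ⟨k, l, hQ⟩ := shape c Q (fun h => hc ⟨hanti, (h.map some).trans hQw⟩)
  have := main_bound a ha c i j k l (shape2 c _ P hPw hA i j hP) (shape2 c _ Q hQw hA k l hQ)
    P Q hP hQ h2
  have e : (P.map some ++ none :: Q.map some).length = i + j + k + l + 1 := by
    simp [hP, hQ]; omega
  omega

/-- the extremal word -/
def exW (n : ℕ) : List (Option Bool) :=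
  List.replicate (2 * n + 1) (some false) ++ some true :: none :: List.replicate (2 * n) (some false)

theorem exW_len (n : ℕ) : (exW n).length = 4 * n + 3 := by
  simp [exW]; omega

theorem exW_get (n i : ℕ) (hi : i < 4 * n + 3) :
    (exW n)[i]? = some (if i = 2 * n + 2 then none else some (decide (i = 2 * n + 1))) := by
  unfold exW
  simp only [List.getElem?_append, List.getElem?_cons, List.length_replicate,
    List.getElem?_replicate]
  rcases lt_trichotomy i (2 * n + 1) with h | h | h
  · rw [if_pos h, if_pos h, if_neg (by omega), decide_eq_false (by omega)]
  · subst h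
    simp
  · rw [if_neg (by omega), if_neg (by omega), decide_eq_false (by omega)]
    by_cases h' : i = 2 * n + 2
    · rw [if_pos (by omega), if_pos h']
    · rw [if_neg (by omega), if_neg h', if_pos (by omega)]

theorem exW_sq (n : ℕ) : (SqSet (exW n)).ncard ≤ n + 1 := by
  have hsub : SqSet (exW n) ⊆ ↑(insert [true, true] (unarySq false (2 * n))) := by
    rintro u ⟨x, hx, rfl, v, hv, hlen, hcomp⟩
    obtain ⟨d, hd, hv⟩ := infix_idx hv
    rw [exW_len] at hd
    have key : ∀ i, i < (x ++ x).length → d + i ≠ 2 * n + 2 →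
        (x ++ x).getD i false = decide (d + i = 2 * n + 1) := by
      intro i hi hne
      apply hcomp i hi
      rw [List.getD_eq_getElem?_getD, hv i (by omega), exW_get n _ (by omega), if_neg hne]
      rfl
    rw [← hlen] at hd
    simp only [List.length_append] at key hd
    have hpos : 0 < x.length := List.length_pos_iff.2 hx
    simp only [Finset.coe_insert, Set.mem_insert_iff, Finset.mem_coe]
    by_cases ht : true ∈ x
    · left
      obtain ⟨r, hr, hxr⟩ := List.getElem_of_mem ht
      have k1 := key r (by omega)
      have k2 := key (x.length + r) (by omega)
      have g1 : (x ++ x).getD r false = true := by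
        rw [List.getD_eq_getElem?_getD, List.getElem?_append_left hr, List.getElem?_eq_getElem hr, hxr]
        rfl
      have g2 : (x ++ x).getD (x.length + r) false = true := by
        rw [List.getD_eq_getElem?_getD, List.getElem?_append_right (by omega)]
        simp [List.getElem?_eq_getElem hr, hxr]
      rw [g1] at k1
      rw [g2] at k2
      simp only [true_eq_decide_iff] at k1 k2
      have h1 : x.length = 1 := by omega
      obtain ⟨y, rfl⟩ := List.length_eq_one_iff.1 h1
      simp at ht
      subst ht
      rfl
    · right
      have hxr : x = List.replicate x.length false := by
        apply List.eq_replicate_of_mem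
        intro b hb
        cases b
        · rfl
        · exact absurd hb ht
      have hle : ¬ (d ≤ 2 * n + 1 ∧ 2 * n + 1 < d + (x.length + x.length)) := by
        rintro ⟨q1, q2⟩
        have k := key (2 * n + 1 - d) (by omega) (by omega)
        rw [decide_eq_true (by omega)] at k
        rw [List.getD_eq_getElem?_getD, hxr, ← List.replicate_add, List.getElem?_replicate] at k
        split at k <;> simp at k
      unfold unarySq
      simp only [Finset.mem_image, Finset.mem_range]
      refine ⟨x.length - 1, by omega, ?_⟩
      conv_rhs => rw [hxr]
      rw [← List.replicate_add]
      congr 1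
      omega
  refine (Set.ncard_le_ncard hsub (Finset.finite_toSet _)).trans ?_
  rw [Set.ncard_coe_finset]
  refine (Finset.card_insert_le _ _).trans ?_
  rw [unarySq_card]
  omega

theorem exW_anti (n : ℕ) : (AntiSet (exW n)).ncard ≤ 1 := by
  have hsub : AntiSet (exW n) ⊆ {[false, true]} := by
    rintro u ⟨⟨hne, hev, hu⟩, hv⟩
    obtain ⟨d, hd, hv⟩ := infix_idx hv
    rw [exW_len] at hd
    simp only [List.length_map] at hd hv
    have hpos : 0 < u.length := List.length_pos_iff.2 hne
    have key : ∀ i, i < u.length → d + i ≠ 2 * n + 2 ∧ u.getD i false = decide (d + i = 2 * n + 1) := by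
      intro i hi
      have := hv i hi
      rw [exW_get n _ (by omega), List.getElem?_map, List.getElem?_eq_getElem hi] at this
      simp only [Option.map_some, Option.some.injEq] at this
      rw [List.getD_eq_getElem?_getD, List.getElem?_eq_getElem hi]
      split at this
      · simp at this
      · simp only [Option.some.injEq] at this
        exact ⟨by assumption, by simpa using this⟩
    have h0 := hu 0 (by omega)
    rw [(key 0 (by omega)).2, (key (u.length / 2 + 0) (by omega)).2] at h0
    have hor : d = 2 * n + 1 ∨ d + u.length / 2 = 2 * n + 1 := by
      by_contra hcon
      push Not at hcon
      apply h0
      rw [decide_eq_false (by omega), decide_eq_false (by omega)]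
    have hav : ¬ (d ≤ 2 * n + 2 ∧ 2 * n + 2 < d + u.length) := by
      rintro ⟨q1, q2⟩
      exact (key (2 * n + 2 - d) (by omega)).1 (by omega)
    have hl : u.length = 2 := by omega
    obtain ⟨y, z, rfl⟩ := List.length_eq_two.1 hl
    have k0 := (key 0 (by simp)).2
    have k1 := (key 1 (by simp)).2
    simp only [List.length_cons, List.length_nil] at hor hav
    rw [decide_eq_false (by omega)] at k0
    rw [decide_eq_true (by omega)] at k1
    simp at k0 k1
    simp [k0, k1]
  refine (Set.ncard_le_ncard hsub (Set.finite_singleton _)).trans ?_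
  simp

/-- For `a ≥ 2`, the longest one-hole binary partial word with at most `a` distinct
squares and at most one distinct antisquare has length exactly `4a-1`. -/
theorem stmt5 (a : ℕ) (ha : 2 ≤ a) :
    (∃ w : List (Option Bool), OneHole w ∧ (SqSet w).ncard ≤ a ∧ (AntiSet w).ncard ≤ 1 ∧
      w.length = 4*a - 1) ∧
    (∀ w : List (Option Bool), OneHole w → (SqSet w).ncard ≤ a → (AntiSet w).ncard ≤ 1 →
      w.length ≤ 4*a - 1) := by
  refine ⟨⟨exW (a - 1), ?_, ?_, exW_anti _, ?_⟩, fun w h1 h2 h3 => upper a ha w h1 h2 h3⟩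
  · simp [OneHole, exW, List.count_replicate]
  · have := exW_sq (a - 1)
    omega
  · rw [exW_len]
    omega
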